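/- Let n ≥ 1, let Γ be a symmetric positive definite real n×n matrix, let γ ∈ ℝⁿ, and let 𝟙 ∈ ℝⁿ be the all-ones vector. Then the vector λₒ = Γ⁻¹ (γ + ((1 − 𝟙ᵀ Γ⁻¹ γ) / (𝟙ᵀ Γ⁻¹ 𝟙)) 𝟙) is the UNIQUE minimizer of λ ↦ λᵀ Γ λ − 2 γᵀ λ over the set {λ ∈ ℝⁿ : 𝟙ᵀ λ = 1}: if λ ∈ ℝⁿ satisfies 𝟙ᵀ λ = 1, λ ≠ λₒ, then λᵀ Γ λ − 2 γᵀ λ > λₒᵀ Γ λₒ − 2 γᵀ λₒ. -/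

import Mathlib

open Matrix

/-- If `Γ x = γ + c • v` (the stationarity condition for the constraint functional `v`), then `x`
is the strict minimizer of `λ ↦ λᵀΓλ − 2γᵀλ` among the vectors with the same value of `vᵀλ`. -/
theorem Matrix.PosDef.quadratic_lt_of_stationary {ι : Type*} [Fintype ι]
    {Γ : Matrix ι ι ℝ} (hΓ : Γ.PosDef) {γ v x y : ι → ℝ} {c : ℝ}
    (hx : Γ *ᵥ x = γ + c • v) (hv : v ⬝ᵥ y = v ⬝ᵥ x) (hne : y ≠ x) :
    x ⬝ᵥ Γ *ᵥ x - 2 * (γ ⬝ᵥ x) < y ⬝ᵥ Γ *ᵥ y - 2 * (γ ⬝ᵥ y) := by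
  have hpos : 0 < (y - x) ⬝ᵥ Γ *ᵥ (y - x) := by
    simpa using hΓ.dotProduct_mulVec_pos (sub_ne_zero.mpr hne)
  have hsymm : x ⬝ᵥ Γ *ᵥ y = y ⬝ᵥ Γ *ᵥ x := by
    have hT : Γᵀ = Γ := by simpa using hΓ.isHermitian.eq
    rw [dotProduct_mulVec, ← mulVec_transpose, hT, dotProduct_comm]
  have hdot (z : ι → ℝ) : z ⬝ᵥ Γ *ᵥ x = γ ⬝ᵥ z + c * (v ⬝ᵥ z) := by
    rw [hx, dotProduct_add, dotProduct_smul, smul_eq_mul, dotProduct_comm z γ,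
      dotProduct_comm z v]
  rw [mulVec_sub, sub_dotProduct, dotProduct_sub, dotProduct_sub, hsymm, hdot x, hdot y,
    hv] at hpos
  rw [hdot x]
  linarith

/-- The kriging weight vector `λₒ = Γ⁻¹ (γ + ((1 − 𝟙ᵀΓ⁻¹γ)/(𝟙ᵀΓ⁻¹𝟙)) 𝟙)` is the *unique*
minimizer of `λ ↦ λᵀΓλ − 2γᵀλ` over `{λ : 𝟙ᵀλ = 1}`: any other feasible `λ` gives a strictly
larger value. -/
theorem kriging_weights_unique_minimizer (n : ℕ) (hn : 1 ≤ n)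
    (Γ : Matrix (Fin n) (Fin n) ℝ) (hΓ : Γ.PosDef) (γ : Fin n → ℝ) :
    let ones : Fin n → ℝ := fun _ => 1
    let lo : Fin n → ℝ :=
      Γ⁻¹.mulVec (γ + ((1 - ones ⬝ᵥ Γ⁻¹.mulVec γ) / (ones ⬝ᵥ Γ⁻¹.mulVec ones)) • ones)
    ∀ l : Fin n → ℝ, ones ⬝ᵥ l = 1 → l ≠ lo →
      l ⬝ᵥ Γ.mulVec l - 2 * (γ ⬝ᵥ l) > lo ⬝ᵥ Γ.mulVec lo - 2 * (γ ⬝ᵥ lo) := by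
  intro ones lo l hl hne
  have hdet : IsUnit Γ.det := (isUnit_iff_isUnit_det Γ).mp hΓ.isUnit
  have hones : ones ≠ 0 := fun h => one_ne_zero (congrFun h ⟨0, hn⟩)
  have hpos : 0 < ones ⬝ᵥ Γ⁻¹ *ᵥ ones := by
    simpa using hΓ.inv.dotProduct_mulVec_pos hones
  have hstat : Γ *ᵥ lo =
      γ + ((1 - ones ⬝ᵥ Γ⁻¹ *ᵥ γ) / (ones ⬝ᵥ Γ⁻¹ *ᵥ ones)) • ones := by
    rw [mulVec_mulVec, mul_nonsing_inv Γ hdet, one_mulVec]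
  have hlo : ones ⬝ᵥ lo = 1 := by
    unfold lo
    rw [mulVec_add, mulVec_smul, dotProduct_add, dotProduct_smul, smul_eq_mul,
      div_mul_cancel₀ _ hpos.ne']
    ring
  exact hΓ.quadratic_lt_of_stationary hstat (hl.trans hlo.symm) hne
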